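/- arXiv:2009.11097 — 8 statements merged into one kernel-verified Lean document; each statement's English description precedes it below -/
import Mathlib

section
/- Let A₁ be an invertible n×n real matrix, A₂ an m×n real matrix, Σ₂ a symmetric positive definite m×m real matrix, b₁ ∈ ℝⁿ, b₂ ∈ ℝᵐ, and let S be a symmetric positive definite n×n matrix. For ε > 0 let δχ*(ε) denote the unique minimizer of L_ε(x) = (A₁x − b₁)ᵀ(εS)⁻¹(A₁x − b₁) + (A₂x − b₂)ᵀΣ₂⁻¹(A₂x − b₂). Then δχ*(ε) converges to the finite value A₁⁻¹b₁ as ε → 0⁺ (convergence of vectors in ℝⁿ). -/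
open Matrix Filter Topology

/-- A positive definite real quadratic form is bounded below by a positive multiple of the
squared norm. -/
theorem Matrix.PosDef.exists_pos_mul_norm_sq_le {ι : Type*} [Fintype ι]
    {M : Matrix ι ι ℝ} (hM : M.PosDef) :
    ∃ c > 0, ∀ x : ι → ℝ, c * ‖x‖ ^ 2 ≤ x ⬝ᵥ (M *ᵥ x) := by
  have hcont : Continuous fun x : ι → ℝ => x ⬝ᵥ (M *ᵥ x) := by fun_prop
  obtain ⟨c, hc, hmin⟩ : ∃ c > 0, ∀ u ∈ Metric.sphere (0 : ι → ℝ) 1, c ≤ u ⬝ᵥ (M *ᵥ u) := by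
    rcases (Metric.sphere (0 : ι → ℝ) 1).eq_empty_or_nonempty with h | h
    · exact ⟨1, one_pos, by simp [h]⟩
    · obtain ⟨u, hu, hmin⟩ := (isCompact_sphere (0 : ι → ℝ) 1).exists_isMinOn h hcont.continuousOn
      have hu0 : u ≠ 0 := ne_zero_of_mem_unit_sphere ⟨u, hu⟩
      exact ⟨_, by simpa using hM.dotProduct_mulVec_pos hu0, fun v hv => hmin hv⟩
  refine ⟨c, hc, fun x => ?_⟩
  by_cases hx : x = 0
  · simp [hx]
  have hnorm : 0 < ‖x‖ := norm_pos_iff.mpr hx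
  have h := hmin (‖x‖⁻¹ • x) (by simp [norm_smul, hnorm.ne'])
  simp only [mulVec_smul, smul_dotProduct, dotProduct_smul, smul_eq_mul] at h
  calc c * ‖x‖ ^ 2 ≤ (‖x‖⁻¹ * (‖x‖⁻¹ * (x ⬝ᵥ (M *ᵥ x)))) * ‖x‖ ^ 2 := by gcongr
    _ = x ⬝ᵥ (M *ᵥ x) := by field_simp

/-- If a positive definite quadratic form tends to zero along a family of vectors, then so do
the vectors. -/
theorem Matrix.PosDef.tendsto_zero_of_dotProduct_mulVec {ι α : Type*} [Fintype ι]
    {M : Matrix ι ι ℝ} (hM : M.PosDef) {l : Filter α} {r : α → ι → ℝ}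
    (h : Tendsto (fun a => r a ⬝ᵥ (M *ᵥ r a)) l (𝓝 0)) : Tendsto r l (𝓝 0) := by
  obtain ⟨c, hc, hle⟩ := hM.exists_pos_mul_norm_sq_le
  have hsq : Tendsto (fun a => ‖r a‖ ^ 2) l (𝓝 0) :=
    squeeze_zero (fun a => by positivity)
      (fun a => (le_inv_mul_iff₀ hc).mpr (hle (r a))) (by simpa using h.const_mul c⁻¹)
  exact tendsto_zero_iff_norm_tendsto_zero.mpr (by simpa using hsq.sqrt)

/-- as ε → 0⁺, the unique minimizer of the regularized
least-squares cost tends to A₁⁻¹ b₁. -/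
theorem stmt_0 {n m : ℕ}
    (A₁ : Matrix (Fin n) (Fin n) ℝ) (A₂ : Matrix (Fin m) (Fin n) ℝ)
    (Sigma₂ : Matrix (Fin m) (Fin m) ℝ) (S : Matrix (Fin n) (Fin n) ℝ)
    (b₁ : Fin n → ℝ) (b₂ : Fin m → ℝ)
    (hA₁ : IsUnit A₁.det) (hSigma₂ : Sigma₂.PosDef) (hS : S.PosDef)
    (L : ℝ → (Fin n → ℝ) → ℝ)
    (hL : ∀ ε > (0:ℝ), ∀ x, L ε x =
      (A₁ *ᵥ x - b₁) ⬝ᵥ ((ε • S)⁻¹ *ᵥ (A₁ *ᵥ x - b₁)) +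
      (A₂ *ᵥ x - b₂) ⬝ᵥ (Sigma₂⁻¹ *ᵥ (A₂ *ᵥ x - b₂)))
    (δχ : ℝ → (Fin n → ℝ))
    (hδχ : ∀ ε > (0:ℝ), ∀ x, x ≠ δχ ε → L ε (δχ ε) < L ε x) :
    Tendsto δχ (𝓝[>] (0:ℝ)) (𝓝 (A₁⁻¹ *ᵥ b₁)) := by
  have hform_nonneg {k : ℕ} {M : Matrix (Fin k) (Fin k) ℝ} (hM : M.PosDef) (x : Fin k → ℝ) :
      0 ≤ x ⬝ᵥ (M *ᵥ x) := by
    simpa using hM.posSemidef.dotProduct_mulVec_nonneg x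
  set C := (A₂ *ᵥ (A₁⁻¹ *ᵥ b₁) - b₂) ⬝ᵥ (Sigma₂⁻¹ *ᵥ (A₂ *ᵥ (A₁⁻¹ *ᵥ b₁) - b₂)) with hC
  have hcons : A₁ *ᵥ (A₁⁻¹ *ᵥ b₁) - b₁ = 0 := by
    rw [mulVec_mulVec, mul_nonsing_inv _ hA₁, one_mulVec, sub_self]
  have hbound : ∀ ε > (0 : ℝ),
      (A₁ *ᵥ δχ ε - b₁) ⬝ᵥ (S⁻¹ *ᵥ (A₁ *ᵥ δχ ε - b₁)) ≤ ε * C := by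
    intro ε hε
    have hle : L ε (δχ ε) ≤ L ε (A₁⁻¹ *ᵥ b₁) := by
      by_cases h : A₁⁻¹ *ᵥ b₁ = δχ ε
      · rw [h]
      · exact (hδχ ε hε _ h).le
    have hinv : (ε • S)⁻¹ = ε⁻¹ • S⁻¹ :=
      inv_smul' S (Units.mk0 ε hε.ne') ((isUnit_iff_isUnit_det S).mp hS.isUnit)
    rw [hL ε hε, hL ε hε, hcons, zero_dotProduct, zero_add, ← hC, hinv, smul_mulVec,
      dotProduct_smul, smul_eq_mul] at hle
    have hmis := hform_nonneg hSigma₂.inv (A₂ *ᵥ δχ ε - b₂)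
    exact (inv_mul_le_iff₀ hε).mp (by linarith)
  have hres : Tendsto (fun ε => A₁ *ᵥ δχ ε - b₁) (𝓝[>] (0 : ℝ)) (𝓝 0) := by
    refine hS.inv.tendsto_zero_of_dotProduct_mulVec
      (squeeze_zero' (g := fun ε => ε * C) (Eventually.of_forall fun ε => hform_nonneg hS.inv _)
        (eventually_mem_nhdsWithin.mono hbound) ?_)
    have h : Tendsto (fun ε : ℝ => ε * C) (𝓝 0) (𝓝 (0 * C)) := tendsto_id.mul_const C
    rw [zero_mul] at h
    exact h.mono_left nhdsWithin_le_nhds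
  have hrecover : ∀ ε, δχ ε = A₁⁻¹ *ᵥ (A₁ *ᵥ δχ ε - b₁) + A₁⁻¹ *ᵥ b₁ := fun ε => by
    rw [← mulVec_add, sub_add_cancel, mulVec_mulVec, nonsing_inv_mul _ hA₁, one_mulVec]
  have hcont : Continuous fun r : Fin n → ℝ => A₁⁻¹ *ᵥ r + A₁⁻¹ *ᵥ b₁ := by fun_prop
  have hlim := (hcont.tendsto 0).comp hres
  rw [mulVec_zero, zero_add] at hlim
  exact hlim.congr fun ε => (hrecover ε).symm
end

section
/- Let A₁ be an invertible n×n real matrix, A₂ an m×n real matrix, Σ₁ a symmetric positive definite n×n matrix, Σ₂ a symmetric positive definite m×m matrix, b₁ ∈ ℝⁿ, b₂ ∈ ℝᵐ. Set J = A₂A₁⁻¹ and K = Σ₁Jᵀ(JΣ₁Jᵀ + Σ₂)⁻¹. Then δχ* = A₁⁻¹((I − KJ)b₁ + Kb₂) satisfies the normal equations (A₁ᵀΣ₁⁻¹A₁ + A₂ᵀΣ₂⁻¹A₂)δχ* = A₁ᵀΣ₁⁻¹b₁ + A₂ᵀΣ₂⁻¹b₂, and is the unique minimizer of the cost L(x)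 = (A₁x − b₁)ᵀΣ₁⁻¹(A₁x − b₁) + (A₂x − b₂)ᵀΣ₂⁻¹(A₂x − b₂). -/
open Matrix

/-- Expansion of a symmetric quadratic form around a point `r`. -/
theorem Matrix.IsSymm.dotProduct_mulVec_add {ι : Type*} [Fintype ι] {P : Matrix ι ι ℝ}
    (hP : P.IsSymm) (r d : ι → ℝ) :
    (r + d) ⬝ᵥ (P *ᵥ (r + d)) = r ⬝ᵥ (P *ᵥ r) + 2 * (d ⬝ᵥ (P *ᵥ r)) + d ⬝ᵥ (P *ᵥ d) := by
  have hsymm : r ⬝ᵥ (P *ᵥ d) = d ⬝ᵥ (P *ᵥ r) := by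
    rw [dotProduct_mulVec, ← mulVec_transpose, hP.eq, dotProduct_comm]
  rw [mulVec_add, dotProduct_add, add_dotProduct, add_dotProduct, hsymm]
  ring

/-- A stationary point of a weighted two-block least-squares cost is its strict minimizer when the
first block is injective. -/
theorem weightedLeastSquares_lt_of_stationary {ι κ μ : Type*} [Fintype ι] [Fintype κ] [Fintype μ]
    {A : Matrix κ ι ℝ} {B : Matrix μ ι ℝ} {P : Matrix κ κ ℝ} {Q : Matrix μ μ ℝ}
    (hA : Function.Injective A.mulVec) (hP : P.PosDef) (hQ : Q.PosSemidef)
    {b : κ → ℝ} {c : μ → ℝ} {z : ι → ℝ}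
    (hz : Aᵀ *ᵥ (P *ᵥ (A *ᵥ z - b)) + Bᵀ *ᵥ (Q *ᵥ (B *ᵥ z - c)) = 0)
    {x : ι → ℝ} (hx : x ≠ z) :
    (A *ᵥ z - b) ⬝ᵥ (P *ᵥ (A *ᵥ z - b)) + (B *ᵥ z - c) ⬝ᵥ (Q *ᵥ (B *ᵥ z - c)) <
      (A *ᵥ x - b) ⬝ᵥ (P *ᵥ (A *ᵥ x - b)) + (B *ᵥ x - c) ⬝ᵥ (Q *ᵥ (B *ᵥ x - c)) := by
  obtain ⟨h, rfl⟩ : ∃ h, x = z + h := ⟨x - z, by simp⟩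
  have hAh : A *ᵥ h ≠ 0 := fun h0 => hx <| by
    simp [hA (h0.trans (mulVec_zero A).symm)]
  have hpos := hP.dotProduct_mulVec_pos hAh
  have hnonneg := hQ.dotProduct_mulVec_nonneg (B *ᵥ h)
  rw [star_trivial] at hpos hnonneg
  have hcross : (A *ᵥ h) ⬝ᵥ (P *ᵥ (A *ᵥ z - b)) + (B *ᵥ h) ⬝ᵥ (Q *ᵥ (B *ᵥ z - c)) = 0 := by
    have := congrArg (h ⬝ᵥ ·) hz
    rwa [dotProduct_add, dotProduct_mulVec _ Aᵀ, dotProduct_mulVec _ Bᵀ, vecMul_transpose,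
      vecMul_transpose, dotProduct_zero] at this
  have hPs : P.IsSymm := by simpa using hP.isHermitian
  have hQs : Q.IsSymm := by simpa using hQ.isHermitian
  rw [mulVec_add, mulVec_add, add_sub_right_comm, add_sub_right_comm,
    hPs.dotProduct_mulVec_add, hQs.dotProduct_mulVec_add]
  linarith

/-- The residuals of the solution given by the gain `S * Jᵀ * (J * S * Jᵀ + T)⁻¹` are stationary. -/
theorem gain_residual_stationary {κ μ : Type*} [Fintype κ] [Fintype μ] [DecidableEq κ]
    [DecidableEq μ] {S : Matrix κ κ ℝ} {T : Matrix μ μ ℝ} (hS : S.PosDef) (hT : T.PosDef)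
    (J : Matrix μ κ ℝ) (b : κ → ℝ) (c : μ → ℝ) :
    let K := S * Jᵀ * (J * S * Jᵀ + T)⁻¹
    let y := (1 - K * J) *ᵥ b + K *ᵥ c
    S⁻¹ *ᵥ (y - b) + Jᵀ *ᵥ (T⁻¹ *ᵥ (J *ᵥ y - c)) = 0 := by
  intro K y
  have hM : IsUnit (J * S * Jᵀ + T).det := by
    rw [← isUnit_iff_isUnit_det]
    have := hS.posSemidef.mul_mul_conjTranspose_same J
    rw [conjTranspose_eq_transpose_of_trivial] at this
    exact (hT.posSemidef_add this).isUnit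
  have hSu := (isUnit_iff_isUnit_det S).1 hS.isUnit
  have hTu := (isUnit_iff_isUnit_det T).1 hT.isUnit
  set w := (J * S * Jᵀ + T)⁻¹ *ᵥ (c - J *ᵥ b) with hw
  have hMw : (J * S * Jᵀ) *ᵥ w + T *ᵥ w = c - J *ᵥ b := by
    rw [← add_mulVec, hw, mulVec_mulVec, mul_nonsing_inv _ hM, one_mulVec]
  have hy : y = b + S *ᵥ (Jᵀ *ᵥ w) := by
    simp only [y, K, hw, sub_mulVec, one_mulVec, mulVec_sub, mulVec_mulVec, Matrix.mul_assoc]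
    abel
  have hr₁ : S⁻¹ *ᵥ (y - b) = Jᵀ *ᵥ w := by
    rw [hy, add_sub_cancel_left, mulVec_mulVec, nonsing_inv_mul _ hSu, one_mulVec]
  have hr₂ : J *ᵥ y - c = -(T *ᵥ w) := by
    rw [hy, mulVec_add, mulVec_mulVec, mulVec_mulVec,
      eq_sub_of_add_eq hMw]
    abel
  rw [hr₁, hr₂, mulVec_neg, mulVec_mulVec _ T⁻¹, nonsing_inv_mul _ hTu, one_mulVec, mulVec_neg,
    add_neg_cancel]

/-- the robust batch solver formula satisfies the normal
equations and is the unique minimizer of the split least-squares cost. -/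
theorem stmt_1 {n m : ℕ}
    (A₁ : Matrix (Fin n) (Fin n) ℝ) (A₂ : Matrix (Fin m) (Fin n) ℝ)
    (Sigma₁ : Matrix (Fin n) (Fin n) ℝ) (Sigma₂ : Matrix (Fin m) (Fin m) ℝ)
    (b₁ : Fin n → ℝ) (b₂ : Fin m → ℝ)
    (hA₁ : IsUnit A₁.det) (hSigma₁ : Sigma₁.PosDef) (hSigma₂ : Sigma₂.PosDef) :
    let J := A₂ * A₁⁻¹
    let K := Sigma₁ * Jᵀ * (J * Sigma₁ * Jᵀ + Sigma₂)⁻¹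
    let δχ := A₁⁻¹ *ᵥ ((1 - K * J) *ᵥ b₁ + K *ᵥ b₂)
    ((A₁ᵀ * Sigma₁⁻¹ * A₁ + A₂ᵀ * Sigma₂⁻¹ * A₂) *ᵥ δχ =
        A₁ᵀ *ᵥ (Sigma₁⁻¹ *ᵥ b₁) + A₂ᵀ *ᵥ (Sigma₂⁻¹ *ᵥ b₂)) ∧
      (∀ x, x ≠ δχ →
        (A₁ *ᵥ δχ - b₁) ⬝ᵥ (Sigma₁⁻¹ *ᵥ (A₁ *ᵥ δχ - b₁)) +
          (A₂ *ᵥ δχ - b₂) ⬝ᵥ (Sigma₂⁻¹ *ᵥ (A₂ *ᵥ δχ - b₂)) <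
        (A₁ *ᵥ x - b₁) ⬝ᵥ (Sigma₁⁻¹ *ᵥ (A₁ *ᵥ x - b₁)) +
          (A₂ *ᵥ x - b₂) ⬝ᵥ (Sigma₂⁻¹ *ᵥ (A₂ *ᵥ x - b₂))) := by
  intro J K δχ
  have hA : A₁ *ᵥ δχ = (1 - K * J) *ᵥ b₁ + K *ᵥ b₂ := by
    rw [mulVec_mulVec, mul_nonsing_inv _ hA₁, one_mulVec]
  have hJ : J * A₁ = A₂ := by
    rw [Matrix.mul_assoc, nonsing_inv_mul _ hA₁, Matrix.mul_one]
  have hstat : A₁ᵀ *ᵥ (Sigma₁⁻¹ *ᵥ (A₁ *ᵥ δχ - b₁)) +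
      A₂ᵀ *ᵥ (Sigma₂⁻¹ *ᵥ (A₂ *ᵥ δχ - b₂)) = 0 := by
    rw [← hJ, transpose_mul, ← mulVec_mulVec, ← mulVec_mulVec _ J, ← mulVec_add, hA,
      gain_residual_stationary hSigma₁ hSigma₂ J b₁ b₂, mulVec_zero]
  refine ⟨?_, fun x hx => weightedLeastSquares_lt_of_stationary
    (mulVec_injective_of_isUnit ((isUnit_iff_isUnit_det A₁).2 hA₁)) hSigma₁.inv
    hSigma₂.inv.posSemidef hstat hx⟩
  rw [← sub_eq_zero, ← hstat]
  simp only [add_mulVec, mulVec_sub, mulVec_mulVec, Matrix.mul_assoc]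
  abel
end

section
/- Let P and J be n×n real matrices such that J is invertible and P + J⁻¹ is invertible, and let x, y ∈ ℝⁿ. Then x + P(P + J⁻¹)⁻¹(J⁻¹y − x) = (I + PJ)⁻¹(x + Py). -/
open Matrix

/-- the BIFM fusion formula equals its inversion-free form. -/
theorem stmt_4 {n : ℕ}
    (P J : Matrix (Fin n) (Fin n) ℝ) (x y : Fin n → ℝ)
    (hJ : IsUnit J.det) (hPJ : IsUnit (P + J⁻¹).det) :
    x + P *ᵥ ((P + J⁻¹)⁻¹ *ᵥ (J⁻¹ *ᵥ y - x)) =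
      (1 + P * J)⁻¹ *ᵥ (x + P *ᵥ y) := by
  have hfactor : 1 + P * J = (P + J⁻¹) * J := by
    rw [add_mul, nonsing_inv_mul _ hJ, add_comm]
  have hright : P * (P + J⁻¹)⁻¹ = 1 - J⁻¹ * (P + J⁻¹)⁻¹ := by
    rw [eq_sub_iff_add_eq, ← add_mul, mul_nonsing_inv _ hPJ]
  have hleft : (P + J⁻¹)⁻¹ * P = 1 - (P + J⁻¹)⁻¹ * J⁻¹ := by
    rw [eq_sub_iff_add_eq, ← mul_add, nonsing_inv_mul _ hPJ]
  rw [hfactor, Matrix.mul_inv_rev, mulVec_mulVec, hright, mulVec_add, mulVec_mulVec,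
    mul_assoc, hleft]
  simp only [sub_mulVec, mulVec_sub, mul_sub, sub_mul, one_mulVec, mulVec_mulVec, mul_one, one_mul,
    mul_assoc]
  abel
end

section
/- Let P be a symmetric positive definite n×n real matrix, J a symmetric positive semidefinite n×n real matrix, and x, y ∈ ℝⁿ. Then the function f(X) = (X − x)ᵀP⁻¹(X − x) + XᵀJX − 2yᵀX has (I + PJ)⁻¹(x + Py) as its unique minimizer over ℝⁿ. -/
open Matrix

/-- The fused estimate solves the normal equation of the quadratic objective. -/
lemma Matrix.PosDef.inv_add_mulVec_fused {n : Type*} [Fintype n] [DecidableEq n]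
    {P J : Matrix n n ℝ} (hP : P.PosDef) (hJ : J.PosSemidef) (x y : n → ℝ) :
    (P⁻¹ + J) *ᵥ ((1 + P * J)⁻¹ *ᵥ (x + P *ᵥ y)) = P⁻¹ *ᵥ x + y := by
  have hPu : IsUnit P.det := (isUnit_iff_isUnit_det P).1 hP.isUnit
  have hA : IsUnit (P⁻¹ + J).det :=
    (isUnit_iff_isUnit_det _).1 (hP.inv.add_posSemidef hJ).isUnit
  have hfac : 1 + P * J = P * (P⁻¹ + J) := by
    rw [mul_add, mul_nonsing_inv P hPu]
  rw [hfac, mul_inv_rev, mulVec_mulVec, ← mul_assoc, mul_nonsing_inv _ hA, one_mul, mulVec_add,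
    mulVec_mulVec, nonsing_inv_mul P hPu, one_mulVec]

/-- A symmetric real matrix can be moved across the dot product. -/
lemma Matrix.IsHermitian.dotProduct_mulVec_comm {n : Type*} [Fintype n] {M : Matrix n n ℝ}
    (hM : M.IsHermitian) (u v : n → ℝ) : u ⬝ᵥ (M *ᵥ v) = v ⬝ᵥ (M *ᵥ u) := by
  have hT : Mᵀ = M := by simpa [conjTranspose_eq_transpose_of_trivial] using hM.eq
  rw [dotProduct_mulVec, ← mulVec_transpose, hT, dotProduct_comm]

/-- the inversion-free fused estimate (I + PJ)⁻¹(x + Py) is the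
unique minimizer of (X − x)ᵀP⁻¹(X − x) + XᵀJX − 2yᵀX. -/
theorem stmt_6 {n : ℕ}
    (P J : Matrix (Fin n) (Fin n) ℝ) (x y : Fin n → ℝ)
    (hP : P.PosDef) (hJ : J.PosSemidef)
    (f : (Fin n → ℝ) → ℝ)
    (hf : ∀ X, f X = (X - x) ⬝ᵥ (P⁻¹ *ᵥ (X - x)) + X ⬝ᵥ (J *ᵥ X) - 2 * (y ⬝ᵥ X)) :
    ∀ X, X ≠ (1 + P * J)⁻¹ *ᵥ (x + P *ᵥ y) →
      f ((1 + P * J)⁻¹ *ᵥ (x + P *ᵥ y)) < f X := by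
  intro X hX
  have hnormal := hP.inv_add_mulVec_fused hJ x y
  set m := (1 + P * J)⁻¹ *ᵥ (x + P *ᵥ y)
  obtain ⟨d, rfl⟩ : ∃ d, X = m + d := ⟨X - m, by abel⟩
  have hd : d ≠ 0 := by
    rintro rfl
    exact hX (add_zero m)
  have hpos : 0 < d ⬝ᵥ ((P⁻¹ + J) *ᵥ d) := by
    simpa using (hP.inv.add_posSemidef hJ).dotProduct_mulVec_pos hd
  have hgrad := congrArg (d ⬝ᵥ ·) hnormal
  have h1 := hP.inv.isHermitian.dotProduct_mulVec_comm m d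
  have h2 := hP.inv.isHermitian.dotProduct_mulVec_comm x d
  have h3 := hJ.isHermitian.dotProduct_mulVec_comm m d
  have h4 := dotProduct_comm y d
  rw [hf, hf]
  simp only [add_mulVec, mulVec_add, mulVec_sub, dotProduct_add, dotProduct_sub, add_dotProduct,
    sub_dotProduct] at hpos hgrad ⊢
  linarith
end

section
/- Let P be a symmetric positive definite n×n real matrix, R a symmetric positive definite p×p real matrix, H a p×n real matrix, x ∈ ℝⁿ and z ∈ ℝᵖ. Then the function f(X) = (X − x)ᵀP⁻¹(X − x) + (z − HX)ᵀR⁻¹(z − HX) has the unique minimizer X* = x + PHᵀ(HPHᵀ + R)⁻¹(z − Hx). -/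
open Matrix

theorem Matrix.IsSymm.dotProduct_mulVec_add_self {ι α : Type*} [Fintype ι] [CommRing α]
    {A : Matrix ι ι α} (hA : A.IsSymm) (u e : ι → α) :
    (u + e) ⬝ᵥ (A *ᵥ (u + e)) = u ⬝ᵥ (A *ᵥ u) + 2 * (e ⬝ᵥ (A *ᵥ u)) + e ⬝ᵥ (A *ᵥ e) := by
  have h : u ⬝ᵥ (A *ᵥ e) = e ⬝ᵥ (A *ᵥ u) := by
    rw [dotProduct_mulVec, ← mulVec_transpose, hA.eq, dotProduct_comm]
  simp only [mulVec_add, dotProduct_add, add_dotProduct, h]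
  ring

theorem Matrix.PosDef.isSymm {ι : Type*} {A : Matrix ι ι ℝ} (hA : A.PosDef) : A.IsSymm := by
  simpa [IsHermitian, IsSymm, conjTranspose_eq_transpose_of_trivial] using hA.isHermitian

/-- the gain-form Kalman update is the unique MAP estimate. -/
theorem stmt_9 {n p : ℕ}
    (P : Matrix (Fin n) (Fin n) ℝ) (R : Matrix (Fin p) (Fin p) ℝ)
    (H : Matrix (Fin p) (Fin n) ℝ) (x : Fin n → ℝ) (z : Fin p → ℝ)
    (hP : P.PosDef) (hR : R.PosDef)
    (f : (Fin n → ℝ) → ℝ)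
    (hf : ∀ X, f X = (X - x) ⬝ᵥ (P⁻¹ *ᵥ (X - x)) +
      (z - H *ᵥ X) ⬝ᵥ (R⁻¹ *ᵥ (z - H *ᵥ X))) :
    ∀ X, X ≠ x + (P * Hᵀ * (H * P * Hᵀ + R)⁻¹) *ᵥ (z - H *ᵥ x) →
      f (x + (P * Hᵀ * (H * P * Hᵀ + R)⁻¹) *ᵥ (z - H *ᵥ x)) < f X := by
  intro X hX
  have hS : (H * P * Hᵀ + R).PosDef := by
    have h := hP.posSemidef.mul_mul_conjTranspose_same H
    rw [conjTranspose_eq_transpose_of_trivial] at h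
    exact PosDef.posSemidef_add h hR
  have hPdet : IsUnit P.det := (isUnit_iff_isUnit_det P).1 hP.isUnit
  have hRdet : IsUnit R.det := (isUnit_iff_isUnit_det R).1 hR.isUnit
  have hSdet : IsUnit (H * P * Hᵀ + R).det := (isUnit_iff_isUnit_det _).1 hS.isUnit
  set w := (H * P * Hᵀ + R)⁻¹ *ᵥ (z - H *ᵥ x) with hw
  set u := (P * Hᵀ * (H * P * Hᵀ + R)⁻¹) *ᵥ (z - H *ᵥ x) with hu
  have huw : u = P *ᵥ (Hᵀ *ᵥ w) := by
    simp only [hu, hw, mulVec_mulVec, Matrix.mul_assoc]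
  have hPu : P⁻¹ *ᵥ u = Hᵀ *ᵥ w := by
    rw [huw, mulVec_mulVec, nonsing_inv_mul _ hPdet, one_mulVec]
  have hres : z - H *ᵥ (x + u) = R *ᵥ w := by
    have h : (H * P * Hᵀ + R) *ᵥ w = z - H *ᵥ x := by
      rw [hw, mulVec_mulVec, mul_nonsing_inv _ hSdet, one_mulVec]
    rw [add_mulVec, Matrix.mul_assoc, ← mulVec_mulVec, ← mulVec_mulVec, ← huw] at h
    rw [mulVec_add, ← sub_sub, ← h, add_sub_cancel_left]
  have hRw : R⁻¹ *ᵥ (R *ᵥ w) = w := by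
    rw [mulVec_mulVec, nonsing_inv_mul _ hRdet, one_mulVec]
  obtain ⟨e, rfl⟩ : ∃ e, X = x + u + e := ⟨X - (x + u), by abel⟩
  have he : e ≠ 0 := by
    rintro rfl
    exact hX (add_zero _)
  have hres' : z - H *ᵥ (x + u + e) = R *ᵥ w + -(H *ᵥ e) := by
    rw [mulVec_add, ← hres]
    abel
  have hcross : e ⬝ᵥ (Hᵀ *ᵥ w) = (H *ᵥ e) ⬝ᵥ w := by
    rw [dotProduct_mulVec, vecMul_transpose]
  have hepos : 0 < e ⬝ᵥ (P⁻¹ *ᵥ e) := by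
    simpa using hP.inv.dotProduct_mulVec_pos he
  have hHe : 0 ≤ (-(H *ᵥ e)) ⬝ᵥ (R⁻¹ *ᵥ (-(H *ᵥ e))) := by
    simpa only [star_trivial] using hR.inv.posSemidef.dotProduct_mulVec_nonneg (-(H *ᵥ e))
  rw [hf, hf, hres, hres', add_assoc x u e, add_sub_cancel_left, add_sub_cancel_left,
    hP.inv.isSymm.dotProduct_mulVec_add_self, hR.inv.isSymm.dotProduct_mulVec_add_self,
    hPu, hRw, hcross, neg_dotProduct (H *ᵥ e) w]
  linarith
end

section
/- Let P be a symmetric positive semidefinite n×n real matrix, R a symmetric positive definite p×p real matrix, and H a p×n real matrix. Then the updated covariance P⁺ = P − PHᵀ(HPHᵀ + R)⁻¹HP is symmetric positive semidefinite. -/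
open Matrix

/-- The Joseph form of the Kalman covariance update: if `K` satisfies `K (H P Hᵀ + R) = P Hᵀ`, the
gain-form update is a sum of congruences of `P` and `R`. -/
theorem kalman_update_eq_joseph_form {m n α : Type*} [Fintype m] [Fintype n] [DecidableEq n]
    [CommRing α] (P : Matrix n n α) (R : Matrix m m α) (H : Matrix m n α) (K : Matrix n m α)
    (hK : K * (H * P * Hᵀ + R) = P * Hᵀ) :
    P - K * (H * P) = (1 - K * H) * P * (1 - K * H)ᵀ + K * R * Kᵀ := by
  have h : K * (H * (P * (Hᵀ * Kᵀ))) + K * (R * Kᵀ) = P * (Hᵀ * Kᵀ) := by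
    simpa only [Matrix.mul_add, Matrix.add_mul, Matrix.mul_assoc] using congrArg (· * Kᵀ) hK
  simp only [transpose_sub, transpose_one, transpose_mul, Matrix.sub_mul, Matrix.mul_sub,
    Matrix.one_mul, Matrix.mul_one, Matrix.mul_assoc]
  rw [eq_sub_of_add_eq' h]
  abel

/-- the gain-form Kalman covariance update preserves positive
semidefiniteness. -/
theorem stmt_11 {n p : ℕ}
    (P : Matrix (Fin n) (Fin n) ℝ) (R : Matrix (Fin p) (Fin p) ℝ)
    (H : Matrix (Fin p) (Fin n) ℝ)
    (hP : P.PosSemidef) (hR : R.PosDef) :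
    (P - P * Hᵀ * (H * P * Hᵀ + R)⁻¹ * (H * P)).PosSemidef := by
  have hS : (H * P * Hᵀ + R).PosDef := by
    simpa only [conjTranspose_eq_transpose_of_trivial] using
      PosDef.posSemidef_add (hP.mul_mul_conjTranspose_same H) hR
  have hK : P * Hᵀ * (H * P * Hᵀ + R)⁻¹ * (H * P * Hᵀ + R) = P * Hᵀ :=
    nonsing_inv_mul_cancel_right _ _ ((isUnit_iff_isUnit_det _).mp hS.isUnit)
  rw [kalman_update_eq_joseph_form P R H _ hK]
  simpa only [conjTranspose_eq_transpose_of_trivial] using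
    (hP.mul_mul_conjTranspose_same _).add (hR.posSemidef.mul_mul_conjTranspose_same _)
end

section
/- Let J_kk, J_kl, J_lk, J_ll be n×n real matrices and let R be an invertible n×n real matrix such that J_ll + R⁻¹ is invertible. Then (J_kk + R⁻¹) − (J_kl − R⁻¹)(J_ll + R⁻¹)⁻¹(J_lk − R⁻¹) = J_kk + J_kl + J_lk + J_ll − (J_kl + J_ll)(J_ll + R⁻¹)⁻¹(J_lk + J_ll). -/
open Matrix

theorem Matrix.sub_mul_nonsing_inv_mul_sub {m α : Type*} [Fintype m] [DecidableEq m] [CommRing α]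
    (A B S : Matrix m m α) (hS : IsUnit S.det) :
    (A - S) * S⁻¹ * (B - S) = A * S⁻¹ * B - A - B + S := by
  rw [sub_mul, mul_nonsing_inv S hS, sub_mul, one_mul, mul_sub,
    nonsing_inv_mul_cancel_right S A hS]
  abel

/-- exact cancellation of the R⁻¹ terms in the
observe-then-marginalize Schur complement of clone discarding. -/
theorem stmt_12 {n : ℕ}
    (Jkk Jkl Jlk Jll R : Matrix (Fin n) (Fin n) ℝ)
    (hR : IsUnit R.det) (hJll : IsUnit (Jll + R⁻¹).det) :
    (Jkk + R⁻¹) - (Jkl - R⁻¹) * (Jll + R⁻¹)⁻¹ * (Jlk - R⁻¹) =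
      Jkk + Jkl + Jlk + Jll - (Jkl + Jll) * (Jll + R⁻¹)⁻¹ * (Jlk + Jll) := by
  have h := sub_mul_nonsing_inv_mul_sub (Jkl + Jll) (Jlk + Jll) (Jll + R⁻¹) hJll
  rw [show Jkl - R⁻¹ = Jkl + Jll - (Jll + R⁻¹) by abel,
    show Jlk - R⁻¹ = Jlk + Jll - (Jll + R⁻¹) by abel, h]
  abel
end

section
/- Let J_kk, J_kl, J_lk, J_ll be n×n real matrices with J_ll symmetric positive semidefinite. For ε > 0, the matrix J_ll + ε⁻¹I is positive definite (hence invertible), and (J_kk + ε⁻¹I) − (J_kl − ε⁻¹I)(J_ll + ε⁻¹I)⁻¹(J_lk − ε⁻¹I) converges to J_kk + J_kl + J_lk + J_ll as ε → 0⁺ (convergence in the space of n×n real matrices). -/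
open Matrix Filter Topology

theorem Matrix.tendsto_inv_one_add_smul {m : Type*} [Fintype m] [DecidableEq m]
    (J : Matrix m m ℝ) :
    Tendsto (fun ε : ℝ => (1 + ε • J)⁻¹) (𝓝 0) (𝓝 1) := by
  have hcont : Continuous fun ε : ℝ => 1 + ε • J := by fun_prop
  have hdet : Tendsto (fun ε : ℝ => (1 + ε • J).det) (𝓝 0) (𝓝 1) := by
    simpa using hcont.matrix_det.tendsto 0
  have hadj : Tendsto (fun ε : ℝ => (1 + ε • J).adjugate) (𝓝 0) (𝓝 1) := by
    simpa using hcont.matrix_adjugate.tendsto 0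
  simpa [Matrix.inv_def] using (hdet.inv₀ one_ne_zero).smul hadj

/-- The Schur complement with coupling `ε⁻¹`, rewritten without the singular factor `ε⁻¹`. -/
theorem Matrix.schur_complement_inv_smul {m K : Type*} [Fintype m] [DecidableEq m] [Field K]
    (A B C D : Matrix m m K) {ε : K} (hε : ε ≠ 0) (hD : IsUnit (D + ε⁻¹ • (1 : Matrix m m K))) :
    (A + ε⁻¹ • (1 : Matrix m m K)) - (B - ε⁻¹ • 1) * (D + ε⁻¹ • 1)⁻¹ * (C - ε⁻¹ • 1) =
      A + B * (1 + ε • D)⁻¹ + (1 + ε • D)⁻¹ * C + D * (1 + ε • D)⁻¹ -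
        ε • (B * (1 + ε • D)⁻¹ * C) := by
  have hscale : 1 + ε • D = ε • (D + ε⁻¹ • (1 : Matrix m m K)) := by
    rw [smul_add, smul_inv_smul₀ hε, add_comm]
  have hdet : IsUnit (D + ε⁻¹ • (1 : Matrix m m K)).det := (isUnit_iff_isUnit_det _).mp hD
  have hinv : (1 + ε • D)⁻¹ = ε⁻¹ • (D + ε⁻¹ • (1 : Matrix m m K))⁻¹ := by
    rw [hscale]
    exact inv_smul' _ (Units.mk0 ε hε) hdet
  have hmul : D * (D + ε⁻¹ • (1 : Matrix m m K))⁻¹ =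
      1 - ε⁻¹ • (D + ε⁻¹ • (1 : Matrix m m K))⁻¹ := by
    rw [eq_sub_iff_add_eq]
    simpa [add_mul] using mul_nonsing_inv _ hdet
  rw [hinv]
  simp only [mul_smul_comm, smul_mul_assoc, hmul, sub_mul, mul_sub, one_mul, mul_one, smul_sub,
    smul_inv_smul₀ hε]
  abel

/-- the clone-discarding rule is the zero-noise limit of the
observe-then-marginalize procedure. -/
theorem stmt_13 {n : ℕ}
    (Jkk Jkl Jlk Jll : Matrix (Fin n) (Fin n) ℝ)
    (hJll : Jll.PosSemidef) :
    (∀ ε > (0:ℝ), (Jll + ε⁻¹ • (1 : Matrix (Fin n) (Fin n) ℝ)).PosDef) ∧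
      Tendsto
        (fun ε : ℝ =>
          (Jkk + ε⁻¹ • (1 : Matrix (Fin n) (Fin n) ℝ)) -
            (Jkl - ε⁻¹ • 1) * (Jll + ε⁻¹ • 1)⁻¹ * (Jlk - ε⁻¹ • 1))
        (𝓝[>] (0:ℝ)) (𝓝 (Jkk + Jkl + Jlk + Jll)) := by
  have hpos : ∀ ε > (0:ℝ), (Jll + ε⁻¹ • (1 : Matrix (Fin n) (Fin n) ℝ)).PosDef := fun ε hε =>
    PosDef.posSemidef_add hJll (PosDef.one.smul (inv_pos.mpr hε))
  refine ⟨hpos, ?_⟩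
  have hinv := (tendsto_inv_one_add_smul Jll).mono_left (nhdsWithin_le_nhds (s := Set.Ioi 0))
  have hid : Tendsto (fun ε : ℝ => ε) (𝓝[>] 0) (𝓝 0) := nhdsWithin_le_nhds
  have hlim := (((tendsto_const_nhds (x := Jkk)).add (hinv.const_mul Jkl)).add
    (hinv.mul_const Jlk)).add (hinv.const_mul Jll) |>.sub
      (hid.smul ((hinv.const_mul Jkl).mul_const Jlk))
  simp only [mul_one, one_mul, zero_smul, sub_zero] at hlim
  refine hlim.congr' ?_
  filter_upwards [self_mem_nhdsWithin] with ε hε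
  exact (schur_complement_inv_smul Jkk Jkl Jlk Jll (ne_of_gt hε) (hpos ε hε).isUnit).symm
end
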